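/- Let δ ≥ 0, let C > 100δ, and let C' ≥ 0. There exists a constant C₁ (depending only on δ, C and C') with the following property: let X be a geodesic metric space that is δ-hyperbolic in the sense of Gromov, let φ₁ and φ₂ be isometries of X whose almost fixed sets F_C(φ₁) and F_C(φ₂) are nonempty and whose quasiconvex hulls 𝒳_C(φ₁) and 𝒳_C(φ₂) each have diameter at most C', suppose d(𝒳_C(φ₁), 𝒳_C(φ₂)) ≥ C₁, and let p₁ ∈ 𝒳_C(φ₁), p₂ ∈ 𝒳_C(φ₂) realize this distance. Then every element ω of ⟨φ₁, φ₂⟩ admitting a reduced alternating expression ω = φ₂^{m_l} φ₁^{s_l} ⋯ φ₂^{m_1} φ₁^{s_1} with all exponents m_i, s_i nonzero satisfies d(ω·p₁, p₁) ≥ L, where L = 2l is the syllable length of this expression (the number of maximal powers of φ₁ or φ₂ occurring in it). -/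

import Mathlib

/-! Common definitions: geodesic segments, geodesic metric spaces, Gromov hyperbolicity,
almost fixed sets of isometries, quasiconvex hulls, set distance, quasiconvexity. -/

variable {X : Type*}

/-- `γ` is an arclength (isometric) parametrization of a geodesic from `x` to `y`,
defined on the interval `[0, dist x y]`. -/
def GeodesicParam [MetricSpace X] (γ : ℝ → X) (x y : X) : Prop :=
  γ 0 = x ∧ γ (dist x y) = y ∧
    ∀ s ∈ Set.Icc (0 : ℝ) (dist x y), ∀ t ∈ Set.Icc (0 : ℝ) (dist x y),
      dist (γ s) (γ t) = |s - t|

/-- `s` is a geodesic segment joining `x` to `y`. -/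
def IsGeodSegment [MetricSpace X] (s : Set X) (x y : X) : Prop :=
  ∃ γ : ℝ → X, GeodesicParam γ x y ∧ s = γ '' Set.Icc (0 : ℝ) (dist x y)

/-- A geodesic metric space: any two points are joined by a geodesic segment. -/
def IsGeodesicSpace (X : Type*) [MetricSpace X] : Prop :=
  ∀ x y : X, ∃ s : Set X, IsGeodSegment s x y

/-- The Gromov product `(x, y)_p`. -/
noncomputable def gromovProd [MetricSpace X] (p x y : X) : ℝ :=
  (dist p x + dist p y - dist x y) / 2

/-- `X` is δ-hyperbolic in the sense of Gromov: the Gromov product condition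
`(x, y)_p ≥ min ((x, z)_p, (z, y)_p) − δ` holds for all points. -/
def IsGromovHyperbolic (X : Type*) [MetricSpace X] (δ : ℝ) : Prop :=
  ∀ p x y z : X, min (gromovProd p x z) (gromovProd p z y) ≤ gromovProd p x y + δ

/-- The distance between two subsets of a metric space. -/
noncomputable def setDist [MetricSpace X] (A B : Set X) : ℝ :=
  sInf (Set.image2 dist A B)

/-- The almost fixed set `F_C(φ)` of an isometry `φ`. -/
def almostFixedSet [MetricSpace X] (φ : X ≃ᵢ X) (C : ℝ) : Set X :=
  {x | ∃ n : ℤ, n ≠ 0 ∧ dist x ((φ ^ n) x) ≤ C}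

/-- The quasiconvex hull `𝒳_C(φ)`: the union of all geodesic segments joining
pairs of points of the almost fixed set `F_C(φ)`. -/
def qcHull [MetricSpace X] (φ : X ≃ᵢ X) (C : ℝ) : Set X :=
  {y | ∃ p ∈ almostFixedSet φ C, ∃ q ∈ almostFixedSet φ C,
    ∃ s : Set X, IsGeodSegment s p q ∧ y ∈ s}

/-- `Y` is `c`-quasiconvex: every geodesic segment between points of `Y` lies in the
closed `c`-neighborhood of `Y`. -/
def IsQuasiconvexSet [MetricSpace X] (c : ℝ) (Y : Set X) : Prop :=
  ∀ p ∈ Y, ∀ q ∈ Y, ∀ s : Set X, IsGeodSegment s p q → ∀ y ∈ s, Metric.infDist y Y ≤ c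

/-! Gromov's four-point condition turns the statement into a ping-pong argument: once the hulls
are far apart, nonzero powers of `φ₂` send points much closer to `p₁` than to `p₂` to points much
closer to `p₂` than to `p₁`, and conversely, while the distance to the base points increases. -/

section WordLength

variable [MetricSpace X]

/-- `y` lies metrically between `u` and `v`. -/
def MetricBtw (u y v : X) : Prop := dist u y + dist y v = dist u v

theorem MetricBtw.symm {u y v : X} (h : MetricBtw u y v) : MetricBtw v y u := by
  unfold MetricBtw at *
  rw [dist_comm v y, dist_comm y u, dist_comm v u]
  linarith

theorem MetricBtw.trans_left {u y z v : X} (h : MetricBtw u y v) (hz : MetricBtw u z y) :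
    MetricBtw u z v := by
  unfold MetricBtw at *
  linarith [dist_triangle z y v, dist_triangle u z v]

theorem GeodesicParam.metricBtw {γ : ℝ → X} {x y : X} (h : GeodesicParam γ x y) {t : ℝ}
    (ht : t ∈ Set.Icc 0 (dist x y)) :
    dist x (γ t) = t ∧ dist (γ t) y = dist x y - t := by
  obtain ⟨h0, h1, h2⟩ := h
  have ha := h2 0 ⟨le_rfl, dist_nonneg⟩ t ht
  have hb := h2 t ht (dist x y) ⟨dist_nonneg, le_rfl⟩
  rw [h0] at ha
  rw [h1] at hb
  constructor
  · rw [ha, zero_sub, abs_neg, abs_of_nonneg ht.1]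
  · rw [hb, abs_of_nonpos (by linarith [ht.2])]
    ring

theorem IsGeodesicSpace.exists_between (hX : IsGeodesicSpace X) (u v : X) {t : ℝ}
    (ht : t ∈ Set.Icc 0 (dist u v)) :
    ∃ y : X, dist u y = t ∧ dist y v = dist u v - t := by
  obtain ⟨-, γ, hγ, -⟩ := hX u v
  exact ⟨γ t, hγ.metricBtw ht⟩

theorem IsGeodesicSpace.mem_segment_of_metricBtw (hX : IsGeodesicSpace X) {u y v : X}
    (h : MetricBtw u y v) : ∃ s : Set X, IsGeodSegment s u v ∧ y ∈ s := by
  obtain ⟨-, α, hα, -⟩ := hX u y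
  obtain ⟨-, β, hβ, -⟩ := hX y v
  have hα' : ∀ t ∈ Set.Icc 0 (dist u y), _ := fun t ht => hα.metricBtw ht
  have hβ' : ∀ t ∈ Set.Icc 0 (dist y v), _ := fun t ht => hβ.metricBtw ht
  obtain ⟨hα0, hα1, hα2⟩ := hα
  obtain ⟨hβ0, hβ1, hβ2⟩ := hβ
  unfold MetricBtw at h
  have hy : 0 ≤ dist u y := dist_nonneg
  have hv : 0 ≤ dist y v := dist_nonneg
  let γ : ℝ → X := fun t => if t ≤ dist u y then α t else β (t - dist u y)
  have hγ0 : γ 0 = u := by simp [γ, hα0]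
  have hγy : γ (dist u y) = y := by simp [γ, hα1]
  have hγv : γ (dist u v) = v := by
    by_cases hle : dist u v ≤ dist u y
    · have h0 : dist y v = 0 := by linarith
      have huv : dist u v = dist u y := by linarith
      simp only [γ, huv, le_refl, if_true, hα1]
      exact dist_eq_zero.1 h0
    · simp only [γ, if_neg hle]
      rw [show dist u v - dist u y = dist y v by linarith, hβ1]
  have hmixed : ∀ s t : ℝ, 0 ≤ s → s ≤ dist u y → dist u y < t → t ≤ dist u v →
      dist (α s) (β (t - dist u y)) = |s - t| := by
    intro s t hs hsy hyt htv
    have a := hα' s ⟨hs, hsy⟩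
    have b := hβ' (t - dist u y) ⟨by linarith, by linarith⟩
    rw [abs_of_nonpos (by linarith)]
    have h1 := dist_triangle (α s) y (β (t - dist u y))
    have h2 := dist_triangle4 u (α s) (β (t - dist u y)) v
    linarith [a.1, a.2, b.1, b.2]
  refine ⟨γ '' Set.Icc 0 (dist u v), ⟨γ, ⟨hγ0, hγv, ?_⟩, rfl⟩,
    dist u y, ⟨hy, by linarith⟩, hγy⟩
  intro s hs t ht
  by_cases h1 : s ≤ dist u y <;> by_cases h2 : t ≤ dist u y
  · simp only [γ, if_pos h1, if_pos h2]
    exact hα2 s ⟨hs.1, h1⟩ t ⟨ht.1, h2⟩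
  · simp only [γ, if_pos h1, if_neg h2]
    exact hmixed s t hs.1 h1 (not_le.1 h2) ht.2
  · simp only [γ, if_neg h1, if_pos h2]
    rw [dist_comm, abs_sub_comm]
    exact hmixed t s ht.1 h2 (not_le.1 h1) hs.2
  · simp only [γ, if_neg h1, if_neg h2]
    rw [hβ2 _ ⟨by linarith, by linarith [hs.2]⟩ _ ⟨by linarith, by linarith [ht.2]⟩]
    congr 1
    ring

theorem IsGeodesicSpace.mem_qcHull_iff (hX : IsGeodesicSpace X) {φ : X ≃ᵢ X} {C : ℝ} {y : X} :
    y ∈ qcHull φ C ↔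
      ∃ p ∈ almostFixedSet φ C, ∃ q ∈ almostFixedSet φ C, MetricBtw p y q := by
  constructor
  · rintro ⟨p, hp, q, hq, -, ⟨γ, hγ, rfl⟩, t, ht, rfl⟩
    refine ⟨p, hp, q, hq, ?_⟩
    obtain ⟨h1, h2⟩ := hγ.metricBtw ht
    unfold MetricBtw
    linarith
  · rintro ⟨p, hp, q, hq, h⟩
    exact ⟨p, hp, q, hq, hX.mem_segment_of_metricBtw h⟩

theorem IsGeodesicSpace.almostFixedSet_subset_qcHull (hX : IsGeodesicSpace X) (φ : X ≃ᵢ X)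
    (C : ℝ) : almostFixedSet φ C ⊆ qcHull φ C := fun y hy =>
  hX.mem_qcHull_iff.2 ⟨y, hy, y, hy, by simp [MetricBtw]⟩

theorem zpow_apply_mem_almostFixedSet {φ : X ≃ᵢ X} {C : ℝ} {y : X}
    (hy : y ∈ almostFixedSet φ C) (n : ℤ) : (φ ^ n) y ∈ almostFixedSet φ C := by
  obtain ⟨k, hk, h⟩ := hy
  refine ⟨k, hk, ?_⟩
  rwa [← IsometryEquiv.mul_apply, ← zpow_add, add_comm, zpow_add, IsometryEquiv.mul_apply,
    IsometryEquiv.dist_eq]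

theorem IsGeodesicSpace.zpow_apply_mem_qcHull (hX : IsGeodesicSpace X) {φ : X ≃ᵢ X} {C : ℝ}
    {y : X} (hy : y ∈ qcHull φ C) (n : ℤ) : (φ ^ n) y ∈ qcHull φ C := by
  rw [hX.mem_qcHull_iff] at hy ⊢
  obtain ⟨p, hp, q, hq, h⟩ := hy
  refine ⟨_, zpow_apply_mem_almostFixedSet hp n, _, zpow_apply_mem_almostFixedSet hq n, ?_⟩
  simpa only [MetricBtw, IsometryEquiv.dist_eq] using h

variable {δ : ℝ}

theorem IsGromovHyperbolic.four_point (hδ : IsGromovHyperbolic X δ) (p x y z : X) :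
    dist x y + dist p z ≤ dist x z + dist p y + 2 * δ ∨
      dist x y + dist p z ≤ dist z y + dist p x + 2 * δ := by
  have h := hδ p x y z
  unfold gromovProd at h
  rcases min_le_iff.1 h with h | h
  · left
    linarith
  · right
    linarith

/-- Geodesic triangles are `4δ`-thin. -/
theorem IsGromovHyperbolic.exists_dist_le_of_metricBtw (hδ : IsGromovHyperbolic X δ)
    (h0 : 0 ≤ δ) (hX : IsGeodesicSpace X) {u y v : X} (h : MetricBtw u y v) (w : X) :
    ∃ y' : X, (MetricBtw u y' w ∨ MetricBtw w y' v) ∧ dist y y' ≤ 4 * δ := by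
  have key : ∀ {u y v : X}, MetricBtw u y v → dist u y ≤ gromovProd u v w →
      ∃ y' : X, MetricBtw u y' w ∧ dist y y' ≤ 4 * δ := by
    intro u y v h hle
    unfold gromovProd at hle
    unfold MetricBtw at h
    have hvw := dist_triangle u w v
    rw [dist_comm w v] at hvw
    obtain ⟨y', h1, h2⟩ := hX.exists_between u w (t := dist u y)
      ⟨dist_nonneg, by linarith [dist_triangle u v w]⟩
    refine ⟨y', by unfold MetricBtw; linarith, ?_⟩
    have e1 := hδ.four_point u y w v
    have e2 := hδ.four_point u y y' w
    rw [dist_comm w y'] at e2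
    rcases e1 with e1 | e1 <;> rcases e2 with e2 | e2 <;> linarith
  by_cases hle : dist u y ≤ gromovProd u v w
  · obtain ⟨y', h1, h2⟩ := key h hle
    exact ⟨y', Or.inl h1, h2⟩
  · obtain ⟨y', h1, h2⟩ := key h.symm (by
      unfold gromovProd MetricBtw at *
      rw [dist_comm v y, dist_comm v u]
      linarith [dist_comm v w, dist_comm u w])
    exact ⟨y', Or.inr h1.symm, h2⟩

theorem IsGromovHyperbolic.exists_mem_qcHull_dist_le (hδ : IsGromovHyperbolic X δ)
    (h0 : 0 ≤ δ) (hX : IsGeodesicSpace X) {φ : X ≃ᵢ X} {C : ℝ} {a b y : X}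
    (ha : a ∈ qcHull φ C) (hb : b ∈ qcHull φ C) (h : MetricBtw a y b) :
    ∃ y' ∈ qcHull φ C, dist y y' ≤ 8 * δ := by
  obtain ⟨f₁, hf₁, f₂, hf₂, hf⟩ := hX.mem_qcHull_iff.1 ha
  obtain ⟨g₁, hg₁, g₂, hg₂, hg⟩ := hX.mem_qcHull_iff.1 hb
  obtain ⟨y₁, h1 | h1, hd⟩ := hδ.exists_dist_le_of_metricBtw h0 hX h g₁
  · obtain ⟨y₂, h2 | h2, hd'⟩ := hδ.exists_dist_le_of_metricBtw h0 hX h1 f₁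
    · exact ⟨y₂, hX.mem_qcHull_iff.2 ⟨f₁, hf₁, f₂, hf₂, hf.trans_left h2.symm⟩,
        by linarith [dist_triangle y y₁ y₂]⟩
    · exact ⟨y₂, hX.mem_qcHull_iff.2 ⟨f₁, hf₁, g₁, hg₁, h2⟩,
        by linarith [dist_triangle y y₁ y₂]⟩
  · exact ⟨y₁, hX.mem_qcHull_iff.2 ⟨g₁, hg₁, g₂, hg₂, hg.trans_left h1⟩, by linarith⟩

/-- If `P` is a nearest point to `Q` in the hull, then paths from `Q` to the hull nearly pass
through `P`. -/
theorem IsGromovHyperbolic.le_dist_of_nearest (hδ : IsGromovHyperbolic X δ)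
    (h0 : 0 ≤ δ) (hX : IsGeodesicSpace X) {φ : X ≃ᵢ X} {C : ℝ} {P Q b : X}
    (hP : P ∈ qcHull φ C) (hmin : ∀ a ∈ qcHull φ C, dist P Q ≤ dist a Q)
    (hb : b ∈ qcHull φ C) : dist P Q + dist P b - 20 * δ ≤ dist Q b := by
  have t1 := dist_triangle P Q b
  have t2 := dist_triangle Q P b
  have t3 := dist_triangle P b Q
  rw [dist_comm Q P] at t2
  rw [dist_comm b Q] at t3
  obtain ⟨y, h1, h2⟩ := hX.exists_between P b (t := gromovProd P Q b)
    ⟨by unfold gromovProd; linarith, by unfold gromovProd; linarith⟩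
  obtain ⟨y', hy', hd⟩ := hδ.exists_mem_qcHull_dist_le h0 hX hP hb (y := y)
    (by unfold MetricBtw; linarith)
  have h3 := hmin y' hy'
  have h4 := dist_triangle y' y Q
  unfold gromovProd at h1 h2
  have h5 := hδ.four_point P Q y b
  rw [dist_comm b y] at h5
  rw [dist_comm y' y, dist_comm y Q] at h4
  rcases h5 with h5 | h5 <;> linarith

/-- If `P` is a nearest point to `Q` in the hull of `φ`, then the segments from `P` to `Q` and to
the image of `Q` under a nonzero power of `φ` diverge quickly. -/
theorem IsGromovHyperbolic.le_dist_zpow_apply (hδ : IsGromovHyperbolic X δ)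
    (h0 : 0 ≤ δ) (hX : IsGeodesicSpace X) {φ : X ≃ᵢ X} {C : ℝ} (hC : 100 * δ < C) {P Q : X}
    (hP : P ∈ qcHull φ C) (hmin : ∀ a ∈ qcHull φ C, dist P Q ≤ dist a Q)
    {n : ℤ} (hn : n ≠ 0) :
    dist P Q + dist P ((φ ^ n) Q) - 22 * δ ≤ dist Q ((φ ^ n) Q) := by
  set h := φ ^ n with hh
  have hhP : h P ∈ qcHull φ C := hX.zpow_apply_mem_qcHull hP n
  have hiP : (φ ^ (-n)) P ∈ qcHull φ C := hX.zpow_apply_mem_qcHull hP (-n)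
  have hinv : h ((φ ^ (-n)) P) = P := by
    rw [hh, ← IsometryEquiv.mul_apply, ← zpow_add]
    simp
  have a1 := hδ.le_dist_of_nearest h0 hX hP hmin hhP
  have a2 := hδ.le_dist_of_nearest h0 hX hP hmin hiP
  rw [← h.dist_eq P ((φ ^ (-n)) P), ← h.dist_eq Q ((φ ^ (-n)) P), hinv] at a2
  rw [dist_comm (h P) P, dist_comm (h Q) P] at a2
  by_cases hfar : 21 * δ < dist P (h P)
  · have f := hδ.four_point P Q (h P) (h Q)
    rw [dist_comm (h Q) (h P), h.dist_eq] at f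
    rcases f with f | f <;> linarith
  · by_contra! hlt
    have t1 := dist_triangle P (h P) (h Q)
    have t2 := dist_triangle P Q (h Q)
    have t3 := dist_triangle P (h Q) Q
    have t4 := dist_triangle (h P) P (h Q)
    rw [h.dist_eq, dist_comm (h P) P] at t4
    rw [h.dist_eq] at t1
    rw [dist_comm (h Q) Q] at t3
    obtain ⟨y, h1, h2⟩ := hX.exists_between P Q (t := gromovProd P Q (h Q))
      ⟨by unfold gromovProd; linarith, by unfold gromovProd; linarith⟩
    have hy1 := h.dist_eq P y
    have hy2 := h.dist_eq y Q
    have s1 := dist_triangle P (h P) (h y)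
    have s2 := dist_triangle (h P) P (h y)
    rw [dist_comm (h P) P] at s2
    unfold gromovProd at h1 h2
    have e1 := hδ.four_point P y (h Q) Q
    have e2 := hδ.four_point P y (h y) (h Q)
    rw [dist_comm (h Q) (h y)] at e2
    have hfix : y ∈ almostFixedSet φ C := by
      refine ⟨n, hn, ?_⟩
      change dist y (h y) ≤ C
      rcases e1 with e1 | e1 <;> rcases e2 with e2 | e2 <;> linarith
    have := hmin y (hX.almostFixedSet_subset_qcHull φ C hfix)
    linarith

/-- The ping-pong step. -/
theorem IsGromovHyperbolic.ping_pong (hδ : IsGromovHyperbolic X δ)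
    (h0 : 0 ≤ δ) (hX : IsGeodesicSpace X) {φ : X ≃ᵢ X} {C : ℝ} (hC : 100 * δ < C) {P Q : X}
    (hP : P ∈ qcHull φ C) (hmin : ∀ a ∈ qcHull φ C, dist P Q ≤ dist a Q)
    (hD : 100 * δ + 10 ≤ dist P Q) {n : ℤ} (hn : n ≠ 0) {z : X}
    (hz : dist z Q + (22 * δ + 2) ≤ dist z P) :
    dist z Q + 1 ≤ dist ((φ ^ n) z) P ∧
      dist ((φ ^ n) z) P + (22 * δ + 2) ≤ dist ((φ ^ n) z) Q := by
  have hB := hδ.le_dist_zpow_apply h0 hX hC hP hmin hn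
  have hA := hδ.le_dist_of_nearest h0 hX hP hmin (hX.zpow_apply_mem_qcHull hP (-n))
  have hinv : (φ ^ n) ((φ ^ (-n)) P) = P := by
    rw [← IsometryEquiv.mul_apply, ← zpow_add]
    simp
  set q := (φ ^ (-n)) P
  set h := φ ^ n
  have hzq : dist (h z) P = dist z q := by rw [← hinv, h.dist_eq]
  have hQq : dist P (h Q) = dist Q q := by rw [dist_comm, ← h.dist_eq Q q, hinv]
  have hzQ := h.dist_eq z Q
  have t1 := dist_triangle z q P
  have c1 := dist_comm q P
  have c2 := dist_comm z P
  have c3 := dist_comm (h z) P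
  have c4 := dist_comm (h Q) (h z)
  have c5 := dist_comm Q (h z)
  have c6 := dist_comm q Q
  have c7 := dist_comm Q z
  have c8 := dist_comm (h Q) Q
  have f1 := hδ.four_point P q Q z
  have f2 := hδ.four_point P Q (h Q) (h z)
  have f3 := hδ.four_point P z Q q
  have c9 := dist_comm z q
  constructor
  · rcases f1 with f1 | f1 <;> rcases f3 with f3 | f3 <;> linarith
  · rcases f2 with f2 | f2 <;> linarith

end WordLength

/-- there is a constant `C₁ = C₁(δ, C, C')` such that if the quasiconvex
hulls are at distance at least `C₁`, realized by `p₁, p₂`, then every element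
`ω = φ₂^{m_l} φ₁^{s_l} ⋯ φ₂^{m_1} φ₁^{s_1}` with all exponents nonzero moves `p₁` a
distance at least its syllable length `2l`. -/
theorem word_moves_point_syllable_length (δ C C' : ℝ) (hδ : 0 ≤ δ)
    (hC : 100 * δ < C) (hC' : 0 ≤ C') :
    ∃ C₁ : ℝ, ∀ (X : Type*) [MetricSpace X],
      IsGeodesicSpace X → IsGromovHyperbolic X δ →
      ∀ φ₁ φ₂ : X ≃ᵢ X,
        (almostFixedSet φ₁ C).Nonempty → (almostFixedSet φ₂ C).Nonempty →
        Metric.diam (qcHull φ₁ C) ≤ C' → Metric.diam (qcHull φ₂ C) ≤ C' →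
        C₁ ≤ setDist (qcHull φ₁ C) (qcHull φ₂ C) →
        ∀ p₁ p₂ : X, p₁ ∈ qcHull φ₁ C → p₂ ∈ qcHull φ₂ C →
          dist p₁ p₂ = setDist (qcHull φ₁ C) (qcHull φ₂ C) →
          ∀ (l : ℕ) (m s : ℕ → ℤ), (∀ i < l, m i ≠ 0) → (∀ i < l, s i ≠ 0) →
            ∀ ω : X ≃ᵢ X,
              ω = (List.range l).foldl (fun acc i => φ₂ ^ m i * φ₁ ^ s i * acc) 1 →
              (2 * l : ℝ) ≤ dist (ω p₁) p₁ := by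
  refine ⟨100 * δ + 10, ?_⟩
  intro X _ hX hhyp φ₁ φ₂ _ _ _ _ hD p₁ p₂ hp₁ hp₂ hdist l m s hm hs ω hω
  have hle : ∀ a ∈ qcHull φ₁ C, ∀ b ∈ qcHull φ₂ C, dist p₁ p₂ ≤ dist a b := by
    intro a ha b hb
    rw [hdist]
    refine csInf_le ⟨0, ?_⟩ ⟨a, ha, b, hb, rfl⟩
    rintro _ ⟨x, -, y, -, rfl⟩
    exact dist_nonneg
  have hmin₁ : ∀ a ∈ qcHull φ₁ C, dist p₁ p₂ ≤ dist a p₂ := fun a ha => hle a ha p₂ hp₂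
  have hmin₂ : ∀ b ∈ qcHull φ₂ C, dist p₂ p₁ ≤ dist b p₁ := fun b hb => by
    rw [dist_comm p₂, dist_comm b]
    exact hle p₁ hp₁ b hb
  have hD₁ : 100 * δ + 10 ≤ dist p₁ p₂ := hdist ▸ hD
  have hD₂ : 100 * δ + 10 ≤ dist p₂ p₁ := dist_comm p₁ p₂ ▸ hD₁
  have key : ∀ k : ℕ, k < l →
      let z := (φ₁ ^ s k)
        ((List.range k).foldl (fun acc i => φ₂ ^ m i * φ₁ ^ s i * acc) 1 p₁)
      (2 * k : ℝ) ≤ dist z p₁ ∧ dist z p₁ + (22 * δ + 2) ≤ dist z p₂ := by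
    intro k
    induction k with
    | zero =>
      intro _
      have h := hhyp.le_dist_of_nearest hδ hX hp₁ hmin₁ (hX.zpow_apply_mem_qcHull hp₁ (s 0))
      have c₁ := dist_comm p₁ ((φ₁ ^ s 0) p₁)
      have c₂ := dist_comm p₂ ((φ₁ ^ s 0) p₁)
      simp only [List.range_zero, List.foldl_nil, IsometryEquiv.coe_one, id_eq, Nat.cast_zero,
        mul_zero]
      exact ⟨dist_nonneg, by linarith⟩
    | succ k ih =>
      intro hk
      obtain ⟨h1, h2⟩ := ih (by omega)
      simp only [List.range_succ, List.foldl_append, List.foldl_cons, List.foldl_nil,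
        IsometryEquiv.mul_apply]
      obtain ⟨h3, h4⟩ := hhyp.ping_pong hδ hX hC hp₂ hmin₂ hD₂ (hm k (by omega)) h2
      obtain ⟨h5, h6⟩ := hhyp.ping_pong hδ hX hC hp₁ hmin₁ hD₁ (hs (k + 1) hk) h4
      refine ⟨?_, h6⟩
      push_cast
      linarith
  cases l with
  | zero => simp
  | succ k =>
    obtain ⟨h1, h2⟩ := key k (by omega)
    obtain ⟨h3, h4⟩ :=
      hhyp.ping_pong hδ hX hC hp₂ hmin₂ hD₂ (hm k (by omega)) h2
    rw [hω]
    simp only [List.range_succ, List.foldl_append, List.foldl_cons, List.foldl_nil,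
      IsometryEquiv.mul_apply]
    push_cast
    linarith
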